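/- Let X be a measurable space, n ∈ ℕ, ν : Fin n → Measure X a family of probability measures on X, and U a measurable subset of X. Then the Lebesgue integral with respect to the product measure ⊗_i ν_i of the function sending a tuple x : Fin n → X to the number of indices i with x_i ∈ U equals ∑_{i} ν_i(U). Equivalently, the intensity measure of the point process l[ν_1,…,ν_n] = (K_n)_*(⊗_i ν_i) is the sum ∑_i ν_i of the measures, so that 𝔼 ∘ l = μ^M ∘ i^B i^G on bags of probability measures. -/

import Mathlib

open MeasureTheory
open scoped ENNReal

/-- `bagA U k` is the set `A^U_k` of bags with exactly `k` elements
(counted with multiplicity) lying in `U`. -/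
def bagA {X : Type*} (U : Set X) (k : ℕ) : Set (Multiset X) :=
  {b | @Multiset.countP X (· ∈ U) (Classical.decPred _) b = k}

/-- The bag σ-algebra on `Multiset X`, generated by the sets `A^U_k`
for `U` measurable and `k : ℕ`. -/
instance bagMeasurableSpace (X : Type*) [MeasurableSpace X] : MeasurableSpace (Multiset X) :=
  MeasurableSpace.generateFrom {A | ∃ (U : Set X) (k : ℕ), MeasurableSet U ∧ A = bagA U k}

/-- `iB` sends a bag to its counting measure, the multiplicity-respecting
sum of Dirac measures at its elements. -/
noncomputable def iB {X : Type*} [MeasurableSpace X] (b : Multiset X) : Measure X :=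
  (b.map Measure.dirac).sum

/-- `bagK n` sends an `n`-tuple to the bag of its components. -/
def bagK {X : Type*} (n : ℕ) (x : Fin n → X) : Multiset X :=
  (List.ofFn x : List X)

open Classical in
lemma iB_apply {X : Type*} [MeasurableSpace X] (b : Multiset X) {U : Set X}
    (hU : MeasurableSet U) : iB b U = (b.countP (· ∈ U) : ℝ≥0∞) := by
  induction b using Multiset.induction_on with
  | empty => simp [iB]
  | cons a b ih =>
    rw [iB] at ih
    by_cases ha : a ∈ U <;> simp [iB, Measure.dirac_apply' _ hU, ih, ha, add_comm]

open Classical in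
lemma measurable_countP {X : Type*} [MeasurableSpace X] {U : Set X} (hU : MeasurableSet U) :
    Measurable fun b : Multiset X => b.countP (· ∈ U) := by
  refine measurable_to_countable' fun k => MeasurableSpace.measurableSet_generateFrom
    ⟨U, k, hU, ?_⟩
  ext b
  simp only [bagA, Set.mem_preimage, Set.mem_singleton_iff, Set.mem_ofPred_eq]

lemma measurable_iB {X : Type*} [MeasurableSpace X] :
    Measurable (iB : Multiset X → Measure X) := by
  classical
  refine Measure.measurable_of_measurable_coe _ fun U hU => ?_
  simp only [iB_apply _ hU]
  exact (measurable_of_countable fun k : ℕ => (k : ℝ≥0∞)).comp (measurable_countP hU)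

open Classical in
lemma countP_bagK {X : Type*} (n : ℕ) (x : Fin n → X) (U : Set X) :
    (bagK n x).countP (· ∈ U) = ∑ i, if x i ∈ U then 1 else 0 := by
  have h : bagK n x = Finset.univ.val.map x := by simp [bagK, Fin.univ_val_map]
  rw [h, Multiset.countP_map, ← Finset.card_filter]
  rfl

lemma measurable_bagK {X : Type*} [MeasurableSpace X] (n : ℕ) :
    Measurable (bagK n : (Fin n → X) → Multiset X) := by
  classical
  refine measurable_generateFrom ?_
  rintro _ ⟨U, k, hU, rfl⟩
  have h : Measurable fun x : Fin n → X => ∑ i, if x i ∈ U then 1 else 0 :=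
    Finset.measurable_sum _ fun i _ =>
      Measurable.ite (measurable_pi_apply i hU) measurable_const measurable_const
  convert h (measurableSet_singleton k) using 1
  ext x
  simp only [bagA, Set.mem_preimage, Set.mem_singleton_iff, Set.mem_ofPred_eq, ← countP_bagK]

lemma lintegral_card_mem_pi {X : Type*} [MeasurableSpace X] (n : ℕ) (ν : Fin n → Measure X)
    [∀ i, IsProbabilityMeasure (ν i)] {U : Set X} (hU : MeasurableSet U) :
    ∫⁻ x : Fin n → X, (Nat.card {i : Fin n // x i ∈ U} : ℝ≥0∞) ∂Measure.pi ν
      = ∑ i, ν i U := by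
  classical
  have h (x : Fin n → X) : (Nat.card {i : Fin n // x i ∈ U} : ℝ≥0∞)
      = ∑ i, U.indicator 1 (x i) := by
    simp [Nat.card_eq_fintype_card, Fintype.card_subtype, Set.indicator_apply]
  have hm : Measurable (U.indicator (1 : X → ℝ≥0∞)) := measurable_one.indicator hU
  simp_rw [h]
  rw [lintegral_finsetSum _ fun i _ => by fun_prop]
  refine Finset.sum_congr rfl fun i _ => ?_
  rw [(measurePreserving_eval ν i).lintegral_comp hm, lintegral_indicator_one hU]

/-- `𝔼 ∘ l = μ^M ∘ i^B i^G` on bags of probability measures: the expected number of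
components of a `⊗ᵢ νᵢ`-random tuple lying in `U` is `∑ᵢ νᵢ(U)`; equivalently, the
intensity measure of the point process `l[ν₁,…,νₙ] = (Kₙ)_*(⊗ᵢ νᵢ)` is `∑ᵢ νᵢ`. -/
theorem intensity_distLaw {X : Type*} [MeasurableSpace X] (n : ℕ) (ν : Fin n → Measure X)
    [∀ i, IsProbabilityMeasure (ν i)] :
    (∀ U : Set X, MeasurableSet U →
      ∫⁻ x : Fin n → X, (Nat.card {i : Fin n // x i ∈ U} : ℝ≥0∞) ∂Measure.pi ν
        = ∑ i, ν i U) ∧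
    Measure.join ((Measure.map (bagK n) (Measure.pi ν)).map iB) = ∑ i, ν i := by
  refine ⟨fun U hU => lintegral_card_mem_pi n ν hU, ?_⟩
  classical
  ext U hU
  rw [Measure.join_apply hU, lintegral_map (Measure.measurable_coe hU) measurable_iB,
    lintegral_map (f := fun b => iB b U) ((Measure.measurable_coe hU).comp measurable_iB)
      (measurable_bagK n),
    Measure.finsetSum_apply, ← lintegral_card_mem_pi n ν hU]
  refine lintegral_congr fun x => ?_
  rw [iB_apply _ hU, countP_bagK]
  simp [Nat.card_eq_fintype_card, Fintype.card_subtype]
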